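/- Let P = ⟨H,M,T⟩ be an abduction problem with H = {h₁,…,hₙ}, and let C = {c₁,…,cₙ}, D = {d₁,…,dₙ}, E = {e₁,…,eₙ} be sets of fresh propositional variables in one-to-one correspondence with H. Define P' = ⟨H',M',T'⟩ by H' = C ∪ D, M' = M ∪ E, and T' = { cᵢ → hᵢ, cᵢ → eᵢ, dᵢ → eᵢ : 1 ≤ i ≤ n } ∪ T. Then SOL_≤(P') = { { cᵢ : hᵢ ∈ H₁ } ∪ { dᵢ : hᵢ ∉ H₁ } : H₁ ∈ SOL(P) }. -/

import Mathlib

/-- Propositional formulas over a set `V` of variables. -/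
inductive PropForm (V : Type) : Type where
  | fls  : PropForm V
  | var  : V → PropForm V
  | neg  : PropForm V → PropForm V
  | conj : PropForm V → PropForm V → PropForm V
  | disj : PropForm V → PropForm V → PropForm V
  | imp  : PropForm V → PropForm V → PropForm V
  deriving DecidableEq

namespace PropForm

/-- Truth of a formula under a valuation. -/
def eval {V : Type} (v : V → Prop) : PropForm V → Prop
  | fls => False
  | var x => v x
  | neg φ => ¬ eval v φ
  | conj φ ψ => eval v φ ∧ eval v ψ
  | disj φ ψ => eval v φ ∨ eval v ψ
  | imp φ ψ => eval v φ → eval v ψ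

/-- The set of variables occurring in a formula. -/
def vars {V : Type} : PropForm V → Set V
  | fls => ∅
  | var x => {x}
  | neg φ => vars φ
  | conj φ ψ => vars φ ∪ vars ψ
  | disj φ ψ => vars φ ∪ vars ψ
  | imp φ ψ => vars φ ∪ vars ψ

end PropForm

/-- An abduction problem `⟨H, M, T⟩`: hypotheses, manifestations, theory. -/
structure AbdProblem (V : Type) [DecidableEq V] : Type where
  H : Finset V
  M : Finset V
  T : Finset (PropForm V)

variable {V : Type} [DecidableEq V]

/-- `v` is a model of the hypotheses `A` together with the theory `T`. -/
def models (v : V → Prop) (A : Finset V) (T : Finset (PropForm V)) : Prop :=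
  (∀ x ∈ A, v x) ∧ (∀ φ ∈ T, φ.eval v)

/-- `A` is a solution of `P`: `A ⊆ H`, `A ∪ T` is satisfiable, `A ∪ T ⊨ m` for `m ∈ M`. -/
def isSol (P : AbdProblem V) (A : Finset V) : Prop :=
  A ⊆ P.H ∧ (∃ v, models v A P.T) ∧ ∀ v, models v A P.T → ∀ m ∈ P.M, v m

/-- The set of solutions of `P`. -/
def SOL (P : AbdProblem V) : Set (Finset V) := {A | isSol P A}

/-- The solutions of `P` minimal under set inclusion. -/
def SOLsub (P : AbdProblem V) : Set (Finset V) :=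
  {A | A ∈ SOL P ∧ ∀ B ∈ SOL P, B ⊆ A → B = A}

/-- The solutions of `P` of minimum cardinality. -/
def SOLcard (P : AbdProblem V) : Set (Finset V) :=
  {A | A ∈ SOL P ∧ ∀ B ∈ SOL P, A.card ≤ B.card}

/-- `x` is fresh for `P`: it occurs neither in `H`, nor in `M`, nor in any formula of `T`. -/
def freshFor (P : AbdProblem V) (x : V) : Prop :=
  x ∉ P.H ∧ x ∉ P.M ∧ ∀ φ ∈ P.T, x ∉ φ.vars

/-- The problem `P' = ⟨C ∪ D, M ∪ E, {cᵢ → hᵢ, cᵢ → eᵢ, dᵢ → eᵢ : i} ∪ T⟩`. -/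
def splitProb (P : AbdProblem V) {n : ℕ} (h c d e : Fin n → V) : AbdProblem V where
  H := Finset.univ.image c ∪ Finset.univ.image d
  M := P.M ∪ Finset.univ.image e
  T := Finset.univ.image (fun i => PropForm.imp (PropForm.var (c i)) (PropForm.var (h i)))
    ∪ Finset.univ.image (fun i => PropForm.imp (PropForm.var (c i)) (PropForm.var (e i)))
    ∪ Finset.univ.image (fun i => PropForm.imp (PropForm.var (d i)) (PropForm.var (e i)))
    ∪ P.T

theorem PropForm.eval_congr {W : Type} {v w : W → Prop} {φ : PropForm W}
    (hvw : ∀ x ∈ φ.vars, (v x ↔ w x)) : φ.eval v ↔ φ.eval w := by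
  induction φ with
  | fls => exact Iff.rfl
  | var x => exact hvw x rfl
  | neg φ ih => exact not_congr (ih hvw)
  | conj φ ψ ih₁ ih₂ =>
    exact and_congr (ih₁ fun x hx => hvw x (Or.inl hx)) (ih₂ fun x hx => hvw x (Or.inr hx))
  | disj φ ψ ih₁ ih₂ =>
    exact or_congr (ih₁ fun x hx => hvw x (Or.inl hx)) (ih₂ fun x hx => hvw x (Or.inr hx))
  | imp φ ψ ih₁ ih₂ =>
    exact imp_congr (ih₁ fun x hx => hvw x (Or.inl hx)) (ih₂ fun x hx => hvw x (Or.inr hx))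

section Split

variable {P : AbdProblem V} {n : ℕ} {h c d e : Fin n → V}

theorem models_splitProb_iff {v : V → Prop} {A : Finset V} :
    models v A (splitProb P h c d e).T ↔
      (∀ x ∈ A, v x) ∧ (∀ i, v (c i) → v (h i)) ∧ (∀ i, v (c i) → v (e i)) ∧
        (∀ i, v (d i) → v (e i)) ∧ ∀ φ ∈ P.T, φ.eval v := by
  simp only [models, splitProb, Finset.mem_union, Finset.mem_image, Finset.mem_univ, true_and,
    or_imp, forall_and, forall_exists_index, forall_apply_eq_imp_iff, PropForm.eval, and_assoc]

/-- The choice of `c i` for each `h i` in `B` and of `d i` for each other `h i`. -/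
def splitSet (h c d : Fin n → V) (B : Finset V) : Finset V :=
  (Finset.univ.filter (fun i => h i ∈ B)).image c
    ∪ (Finset.univ.filter (fun i => h i ∉ B)).image d

/-- The hypotheses `h i` whose copy `c i` lies in `A`. -/
def selected (h c : Fin n → V) (A : Finset V) : Finset V :=
  (Finset.univ.filter (fun i => c i ∈ A)).image h

/-- The valuation that follows `A` on the new variables and `w` on all others. -/
def extendVal (c d e : Fin n → V) (A : Finset V) (w : V → Prop) (x : V) : Prop :=
  x ∈ A ∨ (∃ i, x = e i ∧ (c i ∈ A ∨ d i ∈ A)) ∨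
    ((∀ i, x ≠ c i) ∧ (∀ i, x ≠ d i) ∧ (∀ i, x ≠ e i) ∧ w x)

theorem mem_selected (hinj : Function.Injective h) {A : Finset V} {i : Fin n} :
    h i ∈ selected h c A ↔ c i ∈ A := by
  simp [selected, hinj.eq_iff]

theorem left_mem_splitSet (cinj : Function.Injective c) (cd : ∀ i j, c i ≠ d j)
    {B : Finset V} {i : Fin n} : c i ∈ splitSet h c d B ↔ h i ∈ B := by
  simp [splitSet, cinj.eq_iff, (cd _ _).symm]

theorem right_mem_splitSet (dinj : Function.Injective d) (cd : ∀ i j, c i ≠ d j)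
    {B : Finset V} {i : Fin n} : d i ∈ splitSet h c d B ↔ h i ∉ B := by
  simp [splitSet, dinj.eq_iff, cd]

theorem splitSet_subset (B : Finset V) :
    splitSet h c d B ⊆ (splitProb P h c d e).H :=
  Finset.union_subset_union (Finset.image_subset_image (Finset.subset_univ _))
    (Finset.image_subset_image (Finset.subset_univ _))

theorem card_splitSet (cinj : Function.Injective c) (dinj : Function.Injective d)
    (cd : ∀ i j, c i ≠ d j) (B : Finset V) : (splitSet h c d B).card = n := by
  have hdisj : Disjoint ((Finset.univ.filter (fun i => h i ∈ B)).image c)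
      ((Finset.univ.filter (fun i => h i ∉ B)).image d) := by
    simp only [Finset.disjoint_left, Finset.mem_image]
    rintro _ ⟨i, -, rfl⟩ ⟨j, -, hj⟩
    exact cd i j hj.symm
  rw [splitSet, Finset.card_union_of_disjoint hdisj, Finset.card_image_of_injective _ cinj,
    Finset.card_image_of_injective _ dinj, Finset.card_filter_add_card_filter_not,
    Finset.card_univ, Fintype.card_fin]

theorem extendVal_iff {A : Finset V} (hA : A ⊆ (splitProb P h c d e).H) {w : V → Prop} {x : V}
    (hc : ∀ i, x ≠ c i) (hd : ∀ i, x ≠ d i) (he : ∀ i, x ≠ e i) :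
    extendVal c d e A w x ↔ w x := by
  have hxA : x ∉ A := fun hx => by
    have := hA hx
    simp only [splitProb, Finset.mem_union, Finset.mem_image, Finset.mem_univ, true_and] at this
    rcases this with ⟨i, hi⟩ | ⟨i, hi⟩
    exacts [hc i hi.symm, hd i hi.symm]
  simp [extendVal, hxA, hc, hd, he]

theorem models_extendVal (hH : P.H = Finset.univ.image h) (hinj : Function.Injective h)
    (cfresh : ∀ i, freshFor P (c i)) (dfresh : ∀ i, freshFor P (d i))
    (efresh : ∀ i, freshFor P (e i)) (ce : ∀ i j, c i ≠ e j) (de : ∀ i j, d i ≠ e j)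
    {A : Finset V} (hA : A ⊆ (splitProb P h c d e).H) {w : V → Prop}
    (hw : models w (selected h c A) P.T) :
    models (extendVal c d e A w) A (splitProb P h c d e).T := by
  have hmem : ∀ i, h i ∈ P.H := fun i => by simp [hH]
  have hc : ∀ i, extendVal c d e A w (c i) → c i ∈ A := by
    rintro i (hi | ⟨j, hj, -⟩ | ⟨hi, -⟩)
    exacts [hi, absurd hj (ce i j), absurd rfl (hi i)]
  have hd : ∀ i, extendVal c d e A w (d i) → d i ∈ A := by
    rintro i (hi | ⟨j, hj, -⟩ | ⟨-, hi, -⟩)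
    exacts [hi, absurd hj (de i j), absurd rfl (hi i)]
  refine models_splitProb_iff.2 ⟨fun x hx => Or.inl hx, fun i hi => ?_,
    fun i hi => Or.inr (Or.inl ⟨i, rfl, Or.inl (hc i hi)⟩),
    fun i hi => Or.inr (Or.inl ⟨i, rfl, Or.inr (hd i hi)⟩), fun φ hφ => ?_⟩
  · exact (extendVal_iff hA (fun j hj => (cfresh j).1 (hj ▸ hmem i))
      (fun j hj => (dfresh j).1 (hj ▸ hmem i)) (fun j hj => (efresh j).1 (hj ▸ hmem i))).2
      (hw.1 _ ((mem_selected hinj).2 (hc i hi)))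
  · exact (PropForm.eval_congr fun x hx => extendVal_iff hA
      (fun j hj => (cfresh j).2.2 φ hφ (hj ▸ hx)) (fun j hj => (dfresh j).2.2 φ hφ (hj ▸ hx))
      (fun j hj => (efresh j).2.2 φ hφ (hj ▸ hx))).2 (hw.2 φ hφ)

theorem models_selected {v : V → Prop} {A : Finset V}
    (hv : models v A (splitProb P h c d e).T) : models v (selected h c A) P.T := by
  obtain ⟨hA, hch, -, -, hT⟩ := models_splitProb_iff.1 hv
  refine ⟨fun x hx => ?_, hT⟩
  simp only [selected, Finset.mem_image, Finset.mem_filter, Finset.mem_univ, true_and] at hx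
  obtain ⟨i, hi, rfl⟩ := hx
  exact hch i (hA _ hi)

theorem selected_splitSet (hH : P.H = Finset.univ.image h)
    (cinj : Function.Injective c) (cd : ∀ i j, c i ≠ d j) {B : Finset V} (hB : B ⊆ P.H) :
    selected h c (splitSet h c d B) = B := by
  ext x
  simp only [selected, left_mem_splitSet cinj cd, Finset.mem_image, Finset.mem_filter,
    Finset.mem_univ, true_and]
  constructor
  · rintro ⟨i, hi, rfl⟩
    exact hi
  · intro hx
    have hxH := hB hx
    rw [hH, Finset.mem_image] at hxH
    obtain ⟨i, -, rfl⟩ := hxH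
    exact ⟨i, hx, rfl⟩

theorem splitSet_mem_SOL (hH : P.H = Finset.univ.image h) (hinj : Function.Injective h)
    (cinj : Function.Injective c) (dinj : Function.Injective d)
    (cfresh : ∀ i, freshFor P (c i)) (dfresh : ∀ i, freshFor P (d i))
    (efresh : ∀ i, freshFor P (e i))
    (cd : ∀ i j, c i ≠ d j) (ce : ∀ i j, c i ≠ e j) (de : ∀ i j, d i ≠ e j)
    {B : Finset V} (hB : B ∈ SOL P) : splitSet h c d B ∈ SOL (splitProb P h c d e) := by
  obtain ⟨hBH, ⟨w, hw⟩, hent⟩ := hB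
  have hsel : selected h c (splitSet h c d B) = B := selected_splitSet hH cinj cd hBH
  refine ⟨splitSet_subset B, ⟨_, models_extendVal hH hinj cfresh dfresh efresh ce de
    (splitSet_subset B) (hsel.symm ▸ hw)⟩, fun v hv m hm => ?_⟩
  rcases Finset.mem_union.1 hm with hm | hm
  · exact hent v (hsel ▸ models_selected hv) m hm
  · obtain ⟨i, -, rfl⟩ := Finset.mem_image.1 hm
    obtain ⟨hA, -, hce, hde, -⟩ := models_splitProb_iff.1 hv
    by_cases hi : h i ∈ B
    · exact hce i (hA _ ((left_mem_splitSet cinj cd).2 hi))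
    · exact hde i (hA _ ((right_mem_splitSet dinj cd).2 hi))

theorem selected_mem_SOL (hH : P.H = Finset.univ.image h) (hinj : Function.Injective h)
    (cfresh : ∀ i, freshFor P (c i)) (dfresh : ∀ i, freshFor P (d i))
    (efresh : ∀ i, freshFor P (e i)) (ce : ∀ i j, c i ≠ e j) (de : ∀ i j, d i ≠ e j)
    {A : Finset V} (hA : A ∈ SOL (splitProb P h c d e)) : selected h c A ∈ SOL P := by
  obtain ⟨hAH, ⟨v, hv⟩, hent⟩ := hA
  refine ⟨hH ▸ Finset.image_subset_image (Finset.subset_univ _), ⟨v, models_selected hv⟩,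
    fun w hw m hm => ?_⟩
  exact (extendVal_iff hAH (fun j hj => (cfresh j).2.1 (hj ▸ hm))
    (fun j hj => (dfresh j).2.1 (hj ▸ hm)) (fun j hj => (efresh j).2.1 (hj ▸ hm))).1
    (hent _ (models_extendVal hH hinj cfresh dfresh efresh ce de hAH hw) m
      (Finset.mem_union_left _ hm))

theorem splitSet_selected_subset (hH : P.H = Finset.univ.image h)
    (hinj : Function.Injective h) (einj : Function.Injective e)
    (cfresh : ∀ i, freshFor P (c i)) (dfresh : ∀ i, freshFor P (d i))
    (efresh : ∀ i, freshFor P (e i)) (ce : ∀ i j, c i ≠ e j) (de : ∀ i j, d i ≠ e j)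
    {A : Finset V} (hA : A ∈ SOL (splitProb P h c d e)) :
    splitSet h c d (selected h c A) ⊆ A := by
  obtain ⟨hAH, ⟨w, hw⟩, hent⟩ := hA
  intro x hx
  simp only [splitSet, mem_selected hinj, Finset.mem_union, Finset.mem_image, Finset.mem_filter,
    Finset.mem_univ, true_and] at hx
  rcases hx with ⟨i, hi, rfl⟩ | ⟨i, hi, rfl⟩
  · exact hi
  · have hei := hent _ (models_extendVal hH hinj cfresh dfresh efresh ce de hAH
      (models_selected hw)) (e i) (Finset.mem_union_right _ (by simp))
    rcases hei with heA | ⟨j, hj, hcd⟩ | ⟨-, -, hne, -⟩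
    · have := hAH heA
      simp [splitProb, ce, de] at this
    · obtain rfl := einj hj
      exact hcd.resolve_left hi
    · exact absurd rfl (hne i)

end Split

theorem split_min_solutions_eq (P : AbdProblem V) (n : ℕ) (h c d e : Fin n → V)
    (hH : P.H = Finset.univ.image h)
    (hinj : Function.Injective h) (cinj : Function.Injective c)
    (dinj : Function.Injective d) (einj : Function.Injective e)
    (cfresh : ∀ i, freshFor P (c i)) (dfresh : ∀ i, freshFor P (d i))
    (efresh : ∀ i, freshFor P (e i))
    (cd : ∀ i j, c i ≠ d j) (ce : ∀ i j, c i ≠ e j) (de : ∀ i j, d i ≠ e j) :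
    SOLcard (splitProb P h c d e)
      = {A | ∃ H₁ ∈ SOL P,
          A = (Finset.univ.filter (fun i => h i ∈ H₁)).image c
            ∪ (Finset.univ.filter (fun i => h i ∉ H₁)).image d} := by
  ext A
  constructor
  · rintro ⟨hA, hmin⟩
    have hsel := selected_mem_SOL hH hinj cfresh dfresh efresh ce de hA
    refine ⟨_, hsel, (Finset.eq_of_subset_of_card_le
      (splitSet_selected_subset hH hinj einj cfresh dfresh efresh ce de hA)
      (hmin _ ?_)).symm⟩
    exact splitSet_mem_SOL hH hinj cinj dinj cfresh dfresh efresh cd ce de hsel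
  · rintro ⟨H₁, hH₁, rfl⟩
    refine ⟨splitSet_mem_SOL hH hinj cinj dinj cfresh dfresh efresh cd ce de hH₁,
      fun B hB => ?_⟩
    calc (splitSet h c d H₁).card = (splitSet h c d (selected h c B)).card := by
          simp only [card_splitSet cinj dinj cd]
      _ ≤ B.card := Finset.card_le_card
          (splitSet_selected_subset hH hinj einj cfresh dfresh efresh ce de hB)
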